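/- (Criterion for K-congruence) Let K be a class of valuation algebras over A. If P ≡_K Q and for every VA in K and every valuation H in it ∂_P(H) = ∂_Q(H), then P =_K Q. -/

import Mathlib

/-- Propositional statements over atoms `A`: constants `T`, `F`, an atom `a`
for each `a ∈ A`, and the ternary conditional composition
`cond x y z = x ◁ y ▷ z` (with `y` the central condition). -/
inductive PS (A : Type) : Type where
  | tt : PS A
  | ff : PS A
  | atom : A → PS A
  | cond : PS A → PS A → PS A → PS A

/-- A valuation algebra (VA) over `A`. -/
structure VA (A : Type) where
  Val : Type
  Tv : Val
  Fv : Val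
  yd : A → Val → Bool
  dv : A → Val → Val
  yd_T : ∀ a, yd a Tv = true
  yd_F : ∀ a, yd a Fv = false
  dv_T : ∀ a, dv a Tv = Tv
  dv_F : ∀ a, dv a Fv = Fv

variable {A : Type}

mutual
  /-- Evaluation `P/H` of a propositional statement over a valuation `H`. -/
  def PS.eval (V : VA A) : PS A → V.Val → Bool
    | .tt, _ => true
    | .ff, _ => false
    | .atom a, H => V.yd a H
    | .cond p q r, H =>
        if PS.eval V q H then PS.eval V p (PS.deriv V q H)
        else PS.eval V r (PS.deriv V q H)
  /-- The generalized derivative `∂_P(H)`. -/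
  def PS.deriv (V : VA A) : PS A → V.Val → V.Val
    | .tt, H => H
    | .ff, H => H
    | .atom a, H => V.dv a H
    | .cond p q r, H =>
        if PS.eval V q H then PS.deriv V p (PS.deriv V q H)
        else PS.deriv V r (PS.deriv V q H)
end

/-- `K`-equivalence: equal evaluation results in all members of the class `K`. -/
def KEquiv (K : VA A → Prop) (P Q : PS A) : Prop :=
  ∀ V : VA A, K V → ∀ H : V.Val, PS.eval V P H = PS.eval V Q H

/-- A congruence with respect to conditional composition. -/
def IsCondCongruence (R : PS A → PS A → Prop) : Prop :=
  Equivalence R ∧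
    ∀ ⦃x x' y y' z z' : PS A⦄, R x x' → R y y' → R z z' →
      R (PS.cond x y z) (PS.cond x' y' z')

/-- `K`-congruence: the largest congruence contained in `K`-equivalence. -/
def KCong (K : VA A → Prop) (P Q : PS A) : Prop :=
  ∃ R : PS A → PS A → Prop,
    IsCondCongruence R ∧ (∀ x y, R x y → KEquiv K x y) ∧ R P Q

/-- Derivability (of closed equations) in equational logic from the axioms `CP`
together with an additional set `Ax` of equational axioms. -/
inductive Deriv (Ax : PS A → PS A → Prop) : PS A → PS A → Prop where
  | ax {p q} : Ax p q → Deriv Ax p q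
  | cp1 (x y) : Deriv Ax (.cond x .tt y) x
  | cp2 (x y) : Deriv Ax (.cond x .ff y) y
  | cp3 (x) : Deriv Ax (.cond .tt x .ff) x
  | cp4 (x y z u v) :
      Deriv Ax (.cond x (.cond y z u) v)
               (.cond (.cond x y v) z (.cond x u v))
  | refl (x) : Deriv Ax x x
  | symm {p q} : Deriv Ax p q → Deriv Ax q p
  | trans {p q r} : Deriv Ax p q → Deriv Ax q r → Deriv Ax p r
  | congr {x x' y y' z z'} : Deriv Ax x x' → Deriv Ax y y' → Deriv Ax z z' →
      Deriv Ax (.cond x y z) (.cond x' y' z')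

/-- No additional axioms: plain `CP`. -/
def NoAx : PS A → PS A → Prop := fun _ _ => False

/-- The class `fr` of free valuation algebras: all VAs. -/
def frK : VA A → Prop := fun _ => True

/-- The class `rp` of repetition-proof VAs. -/
def rpK (V : VA A) : Prop :=
  ∀ (a : A) (x : V.Val), V.yd a x = V.yd a (V.dv a x)

/-- The class `cr` of contractive VAs. -/
def crK (V : VA A) : Prop :=
  rpK V ∧ ∀ (a : A) (x : V.Val), V.dv a (V.dv a x) = V.dv a x

/-- The class `wm` of weakly memorizing VAs. -/
def wmK (V : VA A) : Prop :=
  crK V ∧ ∀ (a b : A) (x : V.Val),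
    V.yd b (V.dv a x) = V.yd a x →
      V.dv a (V.dv b (V.dv a x)) = V.dv b (V.dv a x) ∧
      V.yd a (V.dv b (V.dv a x)) = V.yd a x

/-- The class `mem` of memorizing VAs. -/
def memK (V : VA A) : Prop :=
  crK V ∧ ∀ (a b : A) (x : V.Val),
    V.dv a (V.dv b (V.dv a x)) = V.dv b (V.dv a x) ∧
    V.yd a (V.dv b (V.dv a x)) = V.yd a x

/-- The class `st` of static VAs. -/
def stK (V : VA A) : Prop :=
  ∀ (a b : A) (x : V.Val), V.yd a (V.dv b x) = V.yd a x

/-- `P` and `Q` have the same evaluation and the same derivative at every valuation of every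
member of `K`. -/
def SameBehavior (K : VA A → Prop) (P Q : PS A) : Prop :=
  ∀ V : VA A, K V → ∀ H : V.Val,
    PS.eval V P H = PS.eval V Q H ∧ PS.deriv V P H = PS.deriv V Q H

theorem SameBehavior.isCondCongruence (K : VA A → Prop) : IsCondCongruence (SameBehavior K) := by
  refine ⟨⟨fun _ _ _ _ => ⟨rfl, rfl⟩, fun h V hV H => ?_, fun h h' V hV H => ?_⟩, ?_⟩
  · exact ⟨(h V hV H).1.symm, (h V hV H).2.symm⟩
  · exact ⟨(h V hV H).1.trans (h' V hV H).1, (h V hV H).2.trans (h' V hV H).2⟩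
  · intro x x' y y' z z' hx hy hz V hV H
    simp only [PS.eval, PS.deriv, hx V hV, hy V hV, hz V hV, and_self]

/-- **Criterion for `K`-congruence**: if `P ≡_K Q` and `∂_P(H) = ∂_Q(H)` for
every valuation `H` of every VA in `K`, then `P =_K Q`. -/
theorem kcong_of_kequiv_of_deriv_eq {A : Type} [Countable A] [Nontrivial A]
    (K : VA A → Prop) (P Q : PS A) (h1 : KEquiv K P Q)
    (h2 : ∀ (V : VA A), K V → ∀ H : V.Val, PS.deriv V P H = PS.deriv V Q H) :
    KCong K P Q := by
  exact ⟨SameBehavior K, SameBehavior.isCondCongruence K, fun _ _ h V hV H => (h V hV H).1,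
    fun V hV H => ⟨h1 V hV H, h2 V hV H⟩⟩
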